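/- Let $f\in L_p(\mathbb{T})$, $1\le p<\infty$, $r\in\mathbb{N}$, and suppose the sampling operators $G_n$, $n\in\mathbb{N}$, satisfy conditions (c1), (c1') and (c2') for some $s\in\mathbb{N}$ with $s\le 2r$. If $\omega_s(f,1/n)_p=o\big(\|f_{\gamma/n,\,r}-f\|_{\ell_p(X_n)}\big)$ as $n\to\infty$, then $\|f-G_n(f)\|_p$ and $\|f_{\gamma/n,\,r}-f\|_{\ell_p(X_n)}$ have the same order: there exist positive constants $c,C$ and $N\in\mathbb{N}$ such that $c\,\|f_{\gamma/n,\,r}-f\|_{\ell_p(X_n)}\le\|f-G_n(f)\|_p\le C\,\|f_{\gamma/n,\,r}-f\|_{\ell_p(X_n)}$ for all $n\ge N$. -/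

import Mathlib

open MeasureTheory Filter Finset

noncomputable def LpNorm (p : ℝ) (f : ℝ → ℝ) : ℝ :=
  (∫ x in (0:ℝ)..1, |f x| ^ p) ^ (1 / p)

def MemLpT (p : ℝ) (f : ℝ → ℝ) : Prop :=
  Function.Periodic f 1 ∧ Measurable f ∧
    IntervalIntegrable (fun x => |f x| ^ p) MeasureTheory.volume 0 1

noncomputable def Delta (r : ℕ) (h : ℝ) (f : ℝ → ℝ) (x : ℝ) : ℝ :=
  ∑ ν ∈ Finset.range (r + 1), ((-1 : ℝ) ^ ν * (r.choose ν : ℝ)) * f (x + ((r : ℝ) - (ν : ℝ)) * h)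

noncomputable def omegaMod (r : ℕ) (p : ℝ) (f : ℝ → ℝ) (δ : ℝ) : ℝ :=
  sSup {y | ∃ h : ℝ, 0 < h ∧ h < δ ∧ y = LpNorm p (Delta r h f)}

noncomputable def steklov (r : ℕ) (δ : ℝ) (f : ℝ → ℝ) (x : ℝ) : ℝ :=
  (-1 : ℝ) ^ (r + 1) * (((2 * r).choose r : ℝ))⁻¹ * (2 / δ) *
    ∫ t in (-(δ / 2))..(δ / 2),
      ∑ ν ∈ Finset.range r,
        (-1 : ℝ) ^ ν * (((2 * r).choose ν : ℝ)) * f (x + (((r : ℝ) - (ν : ℝ)) / (r : ℝ)) * t)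

noncomputable def ellp (p : ℝ) (n : ℕ) (x : ℕ → ℝ) (f : ℝ → ℝ) : ℝ :=
  ((1 / (n : ℝ)) * ∑ k ∈ Finset.range n, |f (x k)| ^ p) ^ (1 / p)

def SobolevW (s : ℕ) (g : ℝ → ℝ) : Prop :=
  Function.Periodic g 1 ∧ ContDiff ℝ (s : ℕ∞) g

noncomputable def localMod (r : ℕ) (f : ℝ → ℝ) (x δ : ℝ) : ℝ :=
  sSup {y | ∃ t h : ℝ, t ∈ Set.Icc (x - r * δ / 2) (x + r * δ / 2) ∧
    (t + r * h) ∈ Set.Icc (x - r * δ / 2) (x + r * δ / 2) ∧ y = |Delta r h f t|}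

noncomputable def tauMod (r : ℕ) (p : ℝ) (f : ℝ → ℝ) (δ : ℝ) : ℝ :=
  (∫ x in (0:ℝ)..1, localMod r f x δ ^ p) ^ (1 / p)

def IsTrigPoly (n : ℕ) (T : ℝ → ℝ) : Prop :=
  ∃ c : ℤ → ℂ, ∀ x : ℝ, (T x : ℂ) =
    ∑ ℓ ∈ Finset.Icc (-(n : ℤ)) (n : ℤ),
      c ℓ * Complex.exp (2 * Real.pi * Complex.I * (ℓ : ℂ) * (x : ℂ))

noncomputable def tildeE (n : ℕ) (p : ℝ) (f : ℝ → ℝ) : ℝ :=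
  sInf {y | ∃ Q q : ℝ → ℝ, IsTrigPoly n Q ∧ IsTrigPoly n q ∧
    (∀ x, q x ≤ f x ∧ f x ≤ Q x) ∧ y = LpNorm p (fun x => Q x - q x)}

noncomputable def dirichlet (n : ℕ) (x : ℝ) : ℝ :=
  ∑ ℓ ∈ Finset.Icc (-(n : ℤ)) (n : ℤ), Real.cos (2 * Real.pi * (ℓ : ℝ) * x)

noncomputable def lagrange (n : ℕ) (f : ℝ → ℝ) (x : ℝ) : ℝ :=
  (1 / (2 * (n : ℝ) + 1)) * ∑ k ∈ Finset.range (2 * n + 1),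
    f ((k : ℝ) / (2 * (n : ℝ) + 1)) * dirichlet n (x - (k : ℝ) / (2 * (n : ℝ) + 1))

def NodesOK (γ : ℝ) (X : ℕ → ℕ → ℝ) : Prop :=
  ∀ n : ℕ, 1 ≤ n →
    (0 ≤ X n 0) ∧ (∀ k, k + 1 < n → X n k < X n (k + 1)) ∧ (X n (n - 1) < 1) ∧
    (∀ k, k + 1 < n → γ / (n : ℝ) ≤ X n (k + 1) - X n k) ∧
    (γ / (n : ℝ) ≤ 1 + X n 0 - X n (n - 1))

def NodesOrd (X : ℕ → ℕ → ℝ) : Prop :=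
  ∀ n : ℕ, 1 ≤ n →
    (0 ≤ X n 0) ∧ (∀ k, k + 1 < n → X n k < X n (k + 1)) ∧ (X n (n - 1) < 1)

def SamplingForm (p : ℝ) (X : ℕ → ℕ → ℝ) (φ : ℕ → ℕ → ℝ → ℝ)
    (G : ℕ → (ℝ → ℝ) → ℝ → ℝ) : Prop :=
  (∀ n k, MemLpT p (φ n k)) ∧
  ∀ (n : ℕ) (f : ℝ → ℝ) (x : ℝ), G n f x = ∑ k ∈ Finset.range n, f (X n k) * φ n k x

def CondC1 (p K1 : ℝ) (X : ℕ → ℕ → ℝ) (G : ℕ → (ℝ → ℝ) → ℝ → ℝ) : Prop :=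
  ∀ f : ℝ → ℝ, MemLpT p f → ∀ n : ℕ, 1 ≤ n → LpNorm p (G n f) ≤ K1 * ellp p n (X n) f

def CondC1' (p K2 : ℝ) (X : ℕ → ℕ → ℝ) (G : ℕ → (ℝ → ℝ) → ℝ → ℝ) : Prop :=
  ∀ f : ℝ → ℝ, MemLpT p f → ∀ n : ℕ, 1 ≤ n → K2 * ellp p n (X n) f ≤ LpNorm p (G n f)

def CondC2' (p K3 : ℝ) (s : ℕ) (G : ℕ → (ℝ → ℝ) → ℝ → ℝ) : Prop :=
  ∀ g : ℝ → ℝ, SobolevW s g → ∀ n : ℕ, 1 ≤ n →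
    LpNorm p (fun x => g x - G n g x) ≤ K3 / (n : ℝ) ^ s * LpNorm p (iteratedDeriv s g)

def CondC3 (p K5 : ℝ) (s : ℕ) (G : ℕ → (ℝ → ℝ) → ℝ → ℝ) : Prop :=
  ∀ f : ℝ → ℝ, MemLpT p f → ∀ n : ℕ, 1 ≤ n →
    SobolevW s (G n f) ∧
    (1 / (n : ℝ) ^ s) * LpNorm p (iteratedDeriv s (G n f)) ≤
      K5 * omegaMod s p (G n f) (1 / (n : ℝ))

noncomputable def Gprev (G : ℕ → (ℝ → ℝ) → ℝ → ℝ) (f : ℝ → ℝ) (ν : ℕ) : ℝ → ℝ :=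
  if ν = 0 then fun _ => 0 else G (2 ^ (ν - 1)) f

def CondC4 (p K4 : ℝ) (s : ℕ) (G : ℕ → (ℝ → ℝ) → ℝ → ℝ) (f : ℝ → ℝ) : Prop :=
  ∀ ν : ℕ,
    SobolevW s (fun x => G (2 ^ ν) f x - Gprev G f ν x) ∧
    LpNorm p (iteratedDeriv s (fun x => G (2 ^ ν) f x - Gprev G f ν x)) ≤
      K4 * 2 ^ (s * ν) * LpNorm p (fun x => G (2 ^ ν) f x - Gprev G f ν x)

noncomputable def Kfun (s : ℕ) (p : ℝ) (n : ℕ) (x : ℕ → ℝ) (f : ℝ → ℝ) : ℝ :=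
  sInf {y | ∃ g : ℝ → ℝ, SobolevW s g ∧
    y = ellp p n x (fun t => f t - g t) + LpNorm p (fun t => f t - g t) +
        (1 / (n : ℝ) ^ s) * LpNorm p (iteratedDeriv s g)}

/-- The extended `L_p` norm over one period. -/
noncomputable def eN (p : ℝ) (f : ℝ → ℝ) : ENNReal :=
  eLpNorm f (ENNReal.ofReal p) (volume.restrict (Set.Ioc (0:ℝ) 1))

theorem memLpT_iff {p : ℝ} (hp : 1 ≤ p) {f : ℝ → ℝ} :
    MemLpT p f ↔ Function.Periodic f 1 ∧ Measurable f ∧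
      MemLp f (ENNReal.ofReal p) (volume.restrict (Set.Ioc (0:ℝ) 1)) := by
  have hp0 : 0 < p := by linarith
  unfold MemLpT
  refine and_congr_right fun _ => and_congr_right fun hm => ?_
  rw [intervalIntegrable_iff_integrableOn_Ioc_of_le zero_le_one, IntegrableOn,
    ← integrable_norm_rpow_iff hm.aestronglyMeasurable (by simpa using hp0) (by simp)]
  simp [ENNReal.toReal_ofReal hp0.le]

theorem MemLpT.memLp {p : ℝ} (hp : 1 ≤ p) {f : ℝ → ℝ} (h : MemLpT p f) :
    MemLp f (ENNReal.ofReal p) (volume.restrict (Set.Ioc (0:ℝ) 1)) := ((memLpT_iff hp).1 h).2.2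

theorem LpNorm_eq {p : ℝ} (hp : 1 ≤ p) {f : ℝ → ℝ} (h : MemLpT p f) :
    LpNorm p f = (eN p f).toReal := by
  have hp0 : 0 < p := by linarith
  unfold eN LpNorm
  rw [(h.memLp hp).eLpNorm_eq_integral_rpow_norm (by simpa using hp0) (by simp),
    ENNReal.toReal_ofReal, intervalIntegral.integral_of_le zero_le_one]
  · simp [ENNReal.toReal_ofReal hp0.le]
  · positivity

theorem ofReal_LpNorm {p : ℝ} (hp : 1 ≤ p) {f : ℝ → ℝ} (h : MemLpT p f) :
    ENNReal.ofReal (LpNorm p f) = eN p f := by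
  rw [LpNorm_eq hp h, ENNReal.ofReal_toReal]
  exact (h.memLp hp).eLpNorm_ne_top

theorem LpNorm_nonneg (p : ℝ) (f : ℝ → ℝ) : 0 ≤ LpNorm p f := by
  unfold LpNorm
  apply Real.rpow_nonneg
  apply intervalIntegral.integral_nonneg zero_le_one
  intro u _
  positivity

theorem MemLpT.add {p : ℝ} (hp : 1 ≤ p) {f g : ℝ → ℝ} (hf : MemLpT p f) (hg : MemLpT p g) :
    MemLpT p (fun x => f x + g x) := by
  rw [memLpT_iff hp] at *
  refine ⟨fun x => ?_, hf.2.1.add hg.2.1, hf.2.2.add hg.2.2⟩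
  simp only [hf.1 x, hg.1 x]

theorem MemLpT.const_mul {p : ℝ} (hp : 1 ≤ p) {f : ℝ → ℝ} (c : ℝ) (hf : MemLpT p f) :
    MemLpT p (fun x => c * f x) := by
  rw [memLpT_iff hp] at *
  refine ⟨fun x => ?_, hf.2.1.const_mul c, hf.2.2.const_mul c⟩
  simp only [hf.1 x]

theorem MemLpT.sub {p : ℝ} (hp : 1 ≤ p) {f g : ℝ → ℝ} (hf : MemLpT p f) (hg : MemLpT p g) :
    MemLpT p (fun x => f x - g x) := by
  rw [memLpT_iff hp] at *
  refine ⟨fun x => ?_, hf.2.1.sub hg.2.1, hf.2.2.sub hg.2.2⟩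
  simp only [hf.1 x, hg.1 x]

theorem MemLpT.zero {p : ℝ} (hp : 1 ≤ p) : MemLpT p (fun _ => 0) := by
  rw [memLpT_iff hp]
  exact ⟨fun x => rfl, measurable_const, MemLp.zero'⟩

theorem MemLpT.sum {p : ℝ} (hp : 1 ≤ p) {ι : Type} (t : Finset ι) {F : ι → ℝ → ℝ}
    (hF : ∀ i ∈ t, MemLpT p (F i)) : MemLpT p (fun x => ∑ i ∈ t, F i x) := by
  classical
  induction t using Finset.induction_on with
  | empty => simpa using MemLpT.zero hp
  | insert a t ha ih =>
    have := (hF a (by simp)).add hp (ih fun i hi => hF i (by simp [hi]))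
    simpa [Finset.sum_insert ha] using this

theorem MemLpT.shift {p : ℝ} {f : ℝ → ℝ} (hf : MemLpT p f) (c : ℝ) :
    MemLpT p (fun x => f (x + c)) := by
  obtain ⟨h1, h2, h3⟩ := hf
  refine ⟨fun x => ?_, h2.comp (measurable_id.add_const c), ?_⟩
  · show f (x + 1 + c) = f (x + c)
    rw [add_right_comm, h1]
  · have hper : Function.Periodic (fun x => |f x| ^ p) 1 := fun x => by simp only [h1 x]
    have := hper.intervalIntegrable₀ one_ne_zero h3 (0 + c) (1 + c)
    simpa using this.comp_add_right c

theorem LpNorm_shift {p : ℝ} {f : ℝ → ℝ} (hf : Function.Periodic f 1) (c : ℝ) :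
    LpNorm p (fun x => f (x + c)) = LpNorm p f := by
  have hper : Function.Periodic (fun x => |f x| ^ p) 1 := fun x => by simp only [hf x]
  unfold LpNorm
  congr 1
  rw [intervalIntegral.integral_comp_add_right (fun x => |f x| ^ p) c]
  have := hper.intervalIntegral_add_eq c 0
  simpa [add_comm] using this

theorem LpNorm_add_le {p : ℝ} (hp : 1 ≤ p) {f g : ℝ → ℝ} (hf : MemLpT p f) (hg : MemLpT p g) :
    LpNorm p (fun x => f x + g x) ≤ LpNorm p f + LpNorm p g := by
  rw [LpNorm_eq hp (hf.add hp hg), LpNorm_eq hp hf, LpNorm_eq hp hg]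
  unfold eN
  rw [← ENNReal.toReal_add (hf.memLp hp).eLpNorm_ne_top (hg.memLp hp).eLpNorm_ne_top]
  apply ENNReal.toReal_mono
  · exact ENNReal.add_ne_top.2 ⟨(hf.memLp hp).eLpNorm_ne_top, (hg.memLp hp).eLpNorm_ne_top⟩
  · exact eLpNorm_add_le (hf.memLp hp).1 (hg.memLp hp).1 (by simpa using hp)

theorem LpNorm_const_mul {p : ℝ} (hp : 1 ≤ p) {f : ℝ → ℝ} (c : ℝ) (hf : MemLpT p f) :
    LpNorm p (fun x => c * f x) = |c| * LpNorm p f := by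
  rw [LpNorm_eq hp (hf.const_mul hp c), LpNorm_eq hp hf]
  unfold eN
  have := eLpNorm_const_smul c f (ENNReal.ofReal p) (volume.restrict (Set.Ioc (0:ℝ) 1))
  have h2 : (fun x => c * f x) = c • f := rfl
  rw [h2, this, ENNReal.toReal_mul]
  simp

theorem LpNorm_sub_comm (p : ℝ) (f g : ℝ → ℝ) :
    LpNorm p (fun x => f x - g x) = LpNorm p (fun x => g x - f x) := by
  unfold LpNorm
  simp only [abs_sub_comm]

theorem LpNorm_zero {p : ℝ} (hp : 1 ≤ p) : LpNorm p (fun _ => 0) = 0 := by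
  rw [LpNorm_eq hp (MemLpT.zero hp)]
  simp [eN]

theorem LpNorm_sum_le {p : ℝ} (hp : 1 ≤ p) {ι : Type} (t : Finset ι) {F : ι → ℝ → ℝ}
    (hF : ∀ i ∈ t, MemLpT p (F i)) :
    LpNorm p (fun x => ∑ i ∈ t, F i x) ≤ ∑ i ∈ t, LpNorm p (F i) := by
  classical
  induction t using Finset.induction_on with
  | empty => simpa using (LpNorm_zero hp).le
  | insert a t ha ih =>
    have h1 := LpNorm_add_le hp (hF a (by simp)) (MemLpT.sum hp t fun i hi => hF i (by simp [hi]))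
    have h2 := ih fun i hi => hF i (by simp [hi])
    simp only [Finset.sum_insert ha]
    linarith

theorem MemLpT.intervalIntegrable {p : ℝ} (hp : 1 ≤ p) {f : ℝ → ℝ} (hf : MemLpT p f) (a b : ℝ) :
    IntervalIntegrable f volume a b := by
  apply hf.1.intervalIntegrable₀ one_ne_zero
  rw [intervalIntegrable_iff_integrableOn_Ioc_of_le zero_le_one]
  exact (hf.memLp hp).integrable (by simpa using hp)

theorem MemLpT.intervalIntegrable_rpow {p : ℝ} {f : ℝ → ℝ} (hf : MemLpT p f) (a b : ℝ) :
    IntervalIntegrable (fun x => |f x| ^ p) volume a b := by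
  have hper : Function.Periodic (fun x => |f x| ^ p) 1 := fun x => by simp only [hf.1 x]
  exact hper.intervalIntegrable₀ one_ne_zero hf.2.2 _ _

theorem MemLpT.of_continuous {p : ℝ} (hp : 1 ≤ p) {f : ℝ → ℝ} (h1 : Function.Periodic f 1)
    (hf : Continuous f) : MemLpT p f := by
  refine ⟨h1, hf.measurable, ?_⟩
  apply Continuous.intervalIntegrable
  exact hf.abs.rpow_const fun x => Or.inr (by linarith)

/-- Jensen's inequality in extended form. -/
theorem jensen_enn {p : ℝ} (hp : 1 ≤ p) {c a : ℝ} (ha : 0 < a) {v : ℝ → ℝ} (hv : Measurable v) :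
    ‖(1 / a) * ∫ u in c..(c + a), v u‖ₑ ^ p ≤
      ENNReal.ofReal (1 / a) * ∫⁻ u in Set.Ioc c (c + a), ‖v u‖ₑ ^ p := by
  have hp0 : 0 < p := by linarith
  have h1 := eLpNorm'_le_eLpNorm'_mul_rpow_measure_univ (p := 1) (q := p) one_pos hp
    (μ := volume.restrict (Set.Ioc c (c + a))) (f := v) hv.aestronglyMeasurable
  simp only [eLpNorm', ENNReal.rpow_one, one_div_one, Measure.restrict_apply_univ,
    Real.volume_Ioc, add_sub_cancel_left] at h1
  have h2 : ‖∫ u in c..(c + a), v u‖ₑ ≤ ∫⁻ u in Set.Ioc c (c + a), ‖v u‖ₑ := by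
    rw [intervalIntegral.integral_of_le (by linarith)]
    exact enorm_integral_le_lintegral_enorm _
  have h3 : ‖(1 / a) * ∫ u in c..(c + a), v u‖ₑ ^ p ≤ (ENNReal.ofReal (1 / a) *
      ((∫⁻ u in Set.Ioc c (c + a), ‖v u‖ₑ ^ p) ^ (1 / p) *
        ENNReal.ofReal a ^ (1 - 1 / p))) ^ p := by
    apply ENNReal.rpow_le_rpow _ hp0.le
    rw [enorm_mul, Real.enorm_of_nonneg (by positivity)]
    gcongr
    exact h2.trans h1
  refine h3.trans (le_of_eq ?_)
  rw [ENNReal.mul_rpow_of_nonneg _ _ hp0.le, ENNReal.mul_rpow_of_nonneg _ _ hp0.le,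
    ← ENNReal.rpow_mul, one_div_mul_cancel hp0.ne', ENNReal.rpow_one, ← ENNReal.rpow_mul,
    mul_comm (∫⁻ u in Set.Ioc c (c + a), ‖v u‖ₑ ^ p), ← mul_assoc]
  congr 1
  rw [ENNReal.ofReal_rpow_of_pos (by positivity), ENNReal.ofReal_rpow_of_pos ha,
    ← ENNReal.ofReal_mul (by positivity)]
  congr 1
  have : (1 - 1 / p) * p = p - 1 := by field_simp
  rw [this, Real.div_rpow zero_le_one ha.le, Real.one_rpow, Real.rpow_sub ha, Real.rpow_one]
  have : 0 < a ^ p := by positivity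
  field_simp

theorem eN_rpow {p : ℝ} (hp : 1 ≤ p) (f : ℝ → ℝ) :
    eN p f ^ p = ∫⁻ x in Set.Ioc (0:ℝ) 1, ‖f x‖ₑ ^ p := by
  have hp0 : 0 < p := by linarith
  unfold eN
  rw [eLpNorm_eq_lintegral_rpow_enorm_toReal (by simpa using hp0) (by simp),
    ENNReal.toReal_ofReal hp0.le, ← ENNReal.rpow_mul, one_div_mul_cancel hp0.ne', ENNReal.rpow_one]

/-- Minkowski's integral inequality for averages. -/
theorem minkowski_avg {p : ℝ} (hp : 1 ≤ p) {a M : ℝ} (ha : 0 < a) {Ψ : ℝ → ℝ → ℝ}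
    (hm : Measurable (Function.uncurry Ψ)) (hΨ : ∀ u ∈ Set.Ioc 0 a, MemLpT p (Ψ u))
    (hM : ∀ u ∈ Set.Ioc 0 a, LpNorm p (Ψ u) ≤ M)
    {F : ℝ → ℝ} (hFp : Function.Periodic F 1) (hFm : Measurable F)
    (hF : ∀ x, F x = (1 / a) * ∫ u in (0:ℝ)..a, Ψ u x) :
    MemLpT p F ∧ LpNorm p F ≤ M := by
  have hp0 : 0 < p := by linarith
  have hM0 : 0 ≤ M := (LpNorm_nonneg _ _).trans (hM a ⟨ha, le_rfl⟩)
  have key : eN p F ≤ ENNReal.ofReal M := by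
    rw [← ENNReal.rpow_le_rpow_iff hp0, eN_rpow hp]
    calc ∫⁻ x in Set.Ioc (0:ℝ) 1, ‖F x‖ₑ ^ p
        ≤ ∫⁻ x in Set.Ioc (0:ℝ) 1, ENNReal.ofReal (1 / a) *
            ∫⁻ u in Set.Ioc 0 a, ‖Ψ u x‖ₑ ^ p := by
          apply lintegral_mono
          intro x
          have := jensen_enn hp (c := 0) ha (v := fun u => Ψ u x)
            (hm.comp (measurable_id.prodMk measurable_const))
          simp only [zero_add] at this
          simpa only [hF x] using this
      _ = ENNReal.ofReal (1 / a) * ∫⁻ u in Set.Ioc 0 a, ∫⁻ x in Set.Ioc (0:ℝ) 1,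
            ‖Ψ u x‖ₑ ^ p := by
          rw [lintegral_const_mul' _ _ (by simp), lintegral_lintegral_swap]
          apply Measurable.aemeasurable
          exact ((hm.comp measurable_swap).enorm).pow_const p
      _ ≤ ENNReal.ofReal (1 / a) * ∫⁻ u in Set.Ioc 0 a, ENNReal.ofReal M ^ p := by
          refine mul_le_mul_right ?_ _
          apply setLIntegral_mono' measurableSet_Ioc
          intro u hu
          rw [← eN_rpow hp, ← ofReal_LpNorm hp (hΨ u hu)]
          gcongr
          exact hM u hu
      _ = ENNReal.ofReal M ^ p := by
          rw [setLIntegral_const, Real.volume_Ioc, sub_zero, mul_comm, mul_assoc,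
            ← ENNReal.ofReal_mul ha.le]
          simp [ha.ne']
  have hmem : MemLpT p F := by
    rw [memLpT_iff hp]
    exact ⟨hFp, hFm, hFm.aestronglyMeasurable, key.trans_lt (by simp)⟩
  refine ⟨hmem, ?_⟩
  rw [← ofReal_LpNorm hp hmem] at key
  exact (ENNReal.ofReal_le_ofReal_iff hM0).1 key

/-- Jensen's inequality, real form. -/
theorem jensen_real {p : ℝ} (hp : 1 ≤ p) {c a : ℝ} (ha : 0 < a) {v : ℝ → ℝ} (hv : Measurable v)
    (hi : IntervalIntegrable (fun x => |v x| ^ p) volume c (c + a)) :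
    |(1 / a) * ∫ u in c..(c + a), v u| ^ p ≤ (1 / a) * ∫ u in c..(c + a), |v u| ^ p := by
  have hp0 : 0 < p := by linarith
  have h := jensen_enn hp (c := c) ha hv
  have h0 : 0 ≤ ∫ u in c..(c + a), |v u| ^ p := by
    apply intervalIntegral.integral_nonneg (by linarith)
    intro u _
    positivity
  rw [← ENNReal.ofReal_le_ofReal_iff (by positivity), ENNReal.ofReal_mul (by positivity),
    intervalIntegral.integral_of_le (by linarith), intervalIntegral.integral_of_le (by linarith),
    ofReal_integral_eq_lintegral_ofReal]
  · rw [intervalIntegral.integral_of_le (by linarith)] at h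
    convert h using 2
    · rw [← ENNReal.ofReal_rpow_of_nonneg (abs_nonneg _) hp0.le, Real.enorm_eq_ofReal_abs]
    · congr 1
      ext u
      rw [← ENNReal.ofReal_rpow_of_nonneg (abs_nonneg _) hp0.le, Real.enorm_eq_ofReal_abs]
  · exact (intervalIntegrable_iff_integrableOn_Ioc_of_le (by linarith)).1 hi
  · exact Eventually.of_forall fun u => by positivity

theorem Delta_eq_fwdDiff (m : ℕ) (h : ℝ) (f : ℝ → ℝ) (x : ℝ) :
    Delta m h f x = (fwdDiff h)^[m] f x := by
  rw [fwdDiff_iter_eq_sum_shift, ← Finset.sum_range_reflect]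
  unfold Delta
  apply Finset.sum_congr rfl
  intro ν hν
  have hν' : ν ≤ m := by simpa [Nat.lt_succ_iff] using hν
  have h1 : m + 1 - 1 - ν = m - ν := by omega
  have h2 : m - (m - ν) = ν := by omega
  rw [h1, h2, Nat.choose_symm hν', zsmul_eq_mul, nsmul_eq_mul, Nat.cast_sub hν']
  push_cast
  ring

theorem Delta_zero (h : ℝ) (f : ℝ → ℝ) (x : ℝ) : Delta 0 h f x = f x := by
  simp [Delta_eq_fwdDiff]

theorem Delta_succ (m : ℕ) (h : ℝ) (f : ℝ → ℝ) (x : ℝ) :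
    Delta (m + 1) h f x = Delta m h f (x + h) - Delta m h f x := by
  simp only [Delta_eq_fwdDiff, Function.iterate_succ_apply']
  rfl

theorem Delta_succ' (m : ℕ) (h : ℝ) (f : ℝ → ℝ) (x : ℝ) :
    Delta (m + 1) h f x = Delta m h (fun y => f (y + h) - f y) x := by
  simp only [Delta_eq_fwdDiff, Function.iterate_succ_apply]
  rfl

theorem Delta_step_zero {m : ℕ} (hm : 1 ≤ m) (f : ℝ → ℝ) (x : ℝ) : Delta m 0 f x = 0 := by
  obtain ⟨k, rfl⟩ : ∃ k, m = k + 1 := ⟨m - 1, by omega⟩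
  rw [Delta_succ]
  simp

theorem Delta_const_mul (m : ℕ) (h c : ℝ) (f : ℝ → ℝ) (x : ℝ) :
    Delta m h (fun y => c * f y) x = c * Delta m h f x := by
  unfold Delta
  rw [Finset.mul_sum]
  exact Finset.sum_congr rfl fun _ _ => by ring

theorem MemLpT.Delta {p : ℝ} (hp : 1 ≤ p) {f : ℝ → ℝ} (hf : MemLpT p f) (m : ℕ) (h : ℝ) :
    MemLpT p (Delta m h f) :=
  MemLpT.sum hp _ fun ν _ => (hf.shift _).const_mul hp _

theorem LpNorm_Delta_le {p : ℝ} (hp : 1 ≤ p) {f : ℝ → ℝ} (hf : MemLpT p f) (m : ℕ) (h : ℝ) :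
    LpNorm p (Delta m h f) ≤ 2 ^ m * LpNorm p f := by
  induction m with
  | zero =>
    have : Delta 0 h f = f := funext fun x => Delta_zero h f x
    simp [this]
  | succ m ih =>
    have e : Delta (m + 1) h f = fun x => Delta m h f (x + h) + (-1) * Delta m h f x := by
      funext x
      rw [Delta_succ]
      ring
    have hD := hf.Delta hp m h
    have h1 := LpNorm_add_le hp (hD.shift h) (hD.const_mul hp (-1))
    rw [LpNorm_const_mul hp _ hD, LpNorm_shift hD.1] at h1
    rw [e]
    simp only [abs_neg, abs_one, one_mul] at h1
    rw [pow_succ]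
    linarith

theorem le_omegaMod {p : ℝ} (hp : 1 ≤ p) {f : ℝ → ℝ} (hf : MemLpT p f) (m : ℕ) {h δ : ℝ}
    (h0 : 0 < h) (h1 : h < δ) : LpNorm p (Delta m h f) ≤ omegaMod m p f δ := by
  apply le_csSup
  · refine ⟨2 ^ m * LpNorm p f, ?_⟩
    rintro y ⟨k, _, _, rfl⟩
    exact LpNorm_Delta_le hp hf m k
  · exact ⟨h, h0, h1, rfl⟩

theorem omegaMod_nonneg (m : ℕ) (p : ℝ) (f : ℝ → ℝ) (δ : ℝ) : 0 ≤ omegaMod m p f δ := by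
  apply Real.sSup_nonneg
  rintro y ⟨k, _, _, rfl⟩
  exact LpNorm_nonneg _ _

/-- One-sided average over `[x, x + a]`, the identity for `a = 0`. -/
noncomputable def avg (a : ℝ) (f : ℝ → ℝ) (x : ℝ) : ℝ :=
  if a = 0 then f x else (1 / a) * ∫ u in (0:ℝ)..a, f (x + u)

theorem avg_zero (f : ℝ → ℝ) : avg 0 f = f := by
  funext x
  simp [avg]

theorem avg_eq {a : ℝ} (ha : a ≠ 0) (f : ℝ → ℝ) (x : ℝ) :
    avg a f x = (1 / a) * ∫ u in (0:ℝ)..a, f (x + u) := by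
  simp [avg, ha]

theorem avg_eq' {a : ℝ} (ha : a ≠ 0) (f : ℝ → ℝ) (x : ℝ) :
    avg a f x = (1 / a) * ∫ u in x..(x + a), f u := by
  rw [avg_eq ha, intervalIntegral.integral_comp_add_left (fun u => f u) x]
  simp

/-- Rescaled form used for the multi-step averages. -/
theorem avg_scaled {η : ℝ} (hη : 0 < η) (j : ℕ) (f : ℝ → ℝ) (x : ℝ) :
    avg ((j : ℝ) * η) f x = (1 / η) * ∫ u in (0:ℝ)..η, f (x + (j : ℝ) * u) := by
  rcases Nat.eq_zero_or_pos j with rfl | hj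
  · simp [avg_zero, hη.ne']
  · have hj' : (0:ℝ) < j := by exact_mod_cast hj
    rw [avg_eq (by positivity)]
    have := intervalIntegral.integral_comp_mul_left (fun u => f (x + u)) hj'.ne' (a := 0) (b := η)
    rw [this]
    simp only [mul_zero, smul_eq_mul]
    field_simp

theorem avg_continuous {a : ℝ} (ha : a ≠ 0) {f : ℝ → ℝ}
    (hf : ∀ c d, IntervalIntegrable f volume c d) : Continuous (avg a f) := by
  have h1 : Continuous fun x => ∫ u in (0:ℝ)..x, f u := intervalIntegral.continuous_primitive hf 0
  have : avg a f = fun x => (1 / a) * ((∫ u in (0:ℝ)..(x + a), f u) - ∫ u in (0:ℝ)..x, f u) := by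
    funext x
    rw [avg_eq' ha, intervalIntegral.integral_interval_sub_left (hf _ _) (hf _ _)]
  rw [this]
  exact ((h1.comp (continuous_id.add continuous_const)).sub h1).const_mul _

theorem avg_periodic {a : ℝ} {f : ℝ → ℝ} (hf : Function.Periodic f 1) :
    Function.Periodic (avg a f) 1 := by
  intro x
  unfold avg
  have : ∀ u, f (x + 1 + u) = f (x + u) := fun u => by rw [add_right_comm, hf]
  simp only [this, hf x]

theorem MemLpT.avg {p : ℝ} (hp : 1 ≤ p) {f : ℝ → ℝ} (hf : MemLpT p f) (a : ℝ) :
    MemLpT p (avg a f) := by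
  by_cases ha : a = 0
  · subst ha
    rwa [avg_zero]
  · exact MemLpT.of_continuous hp (avg_periodic hf.1)
      (avg_continuous ha (hf.intervalIntegrable hp))

theorem LpNorm_avg_le {p : ℝ} (hp : 1 ≤ p) {f : ℝ → ℝ} (hf : MemLpT p f) {a : ℝ} (ha : 0 < a) :
    LpNorm p (avg a f) ≤ LpNorm p f := by
  refine (minkowski_avg hp ha (Ψ := fun u x => f (x + u)) (M := LpNorm p f) ?_ ?_ ?_
    (hf.avg hp a).1 (hf.avg hp a).2.1 (fun x => avg_eq ha.ne' f x)).2
  · exact hf.2.1.comp (measurable_snd.add measurable_fst)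
  · exact fun u _ => hf.shift u
  · exact fun u _ => (LpNorm_shift hf.1 u).le

theorem MemLpT.avg_iter {p : ℝ} (hp : 1 ≤ p) {f : ℝ → ℝ} (hf : MemLpT p f) (a : ℝ) (m : ℕ) :
    MemLpT p ((_root_.avg a)^[m] f) := by
  induction m with
  | zero => exact hf
  | succ m ih =>
    rw [Function.iterate_succ_apply']
    exact ih.avg hp a

theorem avg_hasDerivAt {a : ℝ} (ha : a ≠ 0) {f : ℝ → ℝ} (hf : Continuous f) (x : ℝ) :
    HasDerivAt (avg a f) ((1 / a) * (f (x + a) - f x)) x := by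
  have hi : ∀ c d, IntervalIntegrable f volume c d := fun c d => hf.intervalIntegrable c d
  have : avg a f = fun x => (1 / a) * ((∫ u in (0:ℝ)..(x + a), f u) - ∫ u in (0:ℝ)..x, f u) := by
    funext x
    rw [avg_eq' ha, intervalIntegral.integral_interval_sub_left (hi _ _) (hi _ _)]
  rw [this]
  have h1 : ∀ y, HasDerivAt (fun x => ∫ u in (0:ℝ)..x, f u) (f y) y := fun y =>
    hf.integral_hasStrictDerivAt 0 y |>.hasDerivAt
  exact ((h1 (x + a)).comp_add_const x a |>.sub (h1 x)).const_mul _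

theorem avg_deriv {a : ℝ} (ha : a ≠ 0) {f : ℝ → ℝ} (hf : Continuous f) :
    deriv (avg a f) = fun x => (1 / a) * (f (x + a) - f x) :=
  funext fun x => (avg_hasDerivAt ha hf x).deriv

/-- Averaging commutes with differencing. -/
theorem avg_diff {a : ℝ} (ha : a ≠ 0) {f : ℝ → ℝ} (hf : ∀ c d, IntervalIntegrable f volume c d)
    (c h : ℝ) :
    avg a (fun x => c * (f (x + h) - f x)) = fun x => c * (avg a f (x + h) - avg a f x) := by
  funext x
  have h1 : IntervalIntegrable (fun u => f (x + u + h)) volume 0 a := by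
    have := (hf (x + h + 0) (x + h + a)).comp_add_left (x + h)
    simp only [add_sub_cancel_left] at this
    exact this.congr (by intro u _; simp only; ring_nf)
  have h2 : IntervalIntegrable (fun u => f (x + u)) volume 0 a := by
    have := (hf (x + 0) (x + a)).comp_add_left x
    simpa only [add_sub_cancel_left] using this
  rw [avg_eq ha, avg_eq ha, avg_eq ha, intervalIntegral.integral_const_mul,
    intervalIntegral.integral_sub h1 h2]
  simp only [add_right_comm x _ h]
  ring

theorem avg_iter_contDiff {a : ℝ} (ha : a ≠ 0) {f : ℝ → ℝ}
    (hf : ∀ c d, IntervalIntegrable f volume c d) (m : ℕ) :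
    ContDiff ℝ (m : ℕ∞) ((avg a)^[m + 1] f) := by
  induction m with
  | zero => simpa using avg_continuous ha hf
  | succ m ih =>
    rw [Function.iterate_succ_apply']
    have hc : Continuous ((avg a)^[m + 1] f) := ih.continuous
    have : ((m + 1 : ℕ) : ℕ∞) = (m : ℕ∞) + 1 := by push_cast; rfl
    rw [this]
    push_cast
    rw [contDiff_succ_iff_deriv]
    refine ⟨fun x => (avg_hasDerivAt ha hc x).differentiableAt, by simp, ?_⟩
    rw [avg_deriv ha hc]
    apply contDiff_const.mul
    push_cast at ih
    exact (ih.comp (contDiff_id.add contDiff_const)).sub ih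

theorem avg_iter_iteratedDeriv {a : ℝ} (ha : a ≠ 0) (m : ℕ) : ∀ {f : ℝ → ℝ}
    (_ : ∀ c d, IntervalIntegrable f volume c d),
    iteratedDeriv m ((avg a)^[m + 1] f) = fun x => (1 / a) ^ m * Delta m a (avg a f) x := by
  induction m with
  | zero =>
    intro f hf
    funext x
    simp [Delta_zero]
  | succ m ih =>
    intro f hf
    have hc : Continuous ((avg a)^[m + 1] f) := (avg_iter_contDiff ha hf m).continuous
    have hi : ∀ k : ℕ, ∀ c d, IntervalIntegrable ((avg a)^[k] f) volume c d := by
      intro k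
      cases k with
      | zero => exact hf
      | succ k => exact fun c d => (avg_iter_contDiff ha hf k).continuous.intervalIntegrable c d
    rw [iteratedDeriv_succ', Function.iterate_succ_apply', avg_deriv ha hc]
    have e : ∀ k : ℕ, (fun x => (1 / a) * ((avg a)^[k] f (x + a) - (avg a)^[k] f x)) =
        (avg a)^[k] (fun x => (1 / a) * (f (x + a) - f x)) := by
      intro k
      induction k with
      | zero => rfl
      | succ k ihk =>
        rw [Function.iterate_succ_apply', Function.iterate_succ_apply', ← ihk,
          avg_diff ha (hi k)]
    have hsh : ∀ c d, IntervalIntegrable (fun x => f (x + a)) volume c d := by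
      intro c d
      simpa using (hf (c + a) (d + a)).comp_add_right a
    rw [e, ih (fun c d => ((hsh c d).sub (hf c d)).const_mul _), avg_diff ha hf]
    funext x
    rw [Delta_const_mul, Delta_succ', pow_succ]
    ring

/-- Multi-step averaged difference. -/
noncomputable def Phi (s : ℕ) (η : ℝ) (f : ℝ → ℝ) (m : ℕ) (h x : ℝ) : ℝ :=
  ∑ ν ∈ Finset.range (s + 1), ((-1 : ℝ) ^ ν * (s.choose ν : ℝ)) *
    (avg (((s - ν : ℕ) : ℝ) * η))^[m] f (x + ((s - ν : ℕ) : ℝ) * h)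

theorem Phi_zero (s : ℕ) (η : ℝ) (f : ℝ → ℝ) (h x : ℝ) : Phi s η f 0 h x = Delta s h f x := by
  unfold Phi Delta
  apply Finset.sum_congr rfl
  intro ν hν
  have hν' : ν ≤ s := by simpa [Nat.lt_succ_iff] using hν
  rw [Nat.cast_sub hν']
  rfl

theorem Phi_memLpT {p : ℝ} (hp : 1 ≤ p) {f : ℝ → ℝ} (hf : MemLpT p f) (s : ℕ) (η : ℝ) (m : ℕ)
    (h : ℝ) : MemLpT p (Phi s η f m h) :=
  MemLpT.sum hp _ fun _ _ => ((hf.avg_iter hp _ m).shift _).const_mul hp _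

theorem Phi_measurable {p : ℝ} (hp : 1 ≤ p) {f : ℝ → ℝ} (hf : MemLpT p f) (s : ℕ) (η : ℝ) (m : ℕ)
    (h : ℝ) : Measurable (Function.uncurry fun u x => Phi s η f m (h + u) x) := by
  unfold Phi Function.uncurry
  apply Finset.measurable_fun_sum
  intro ν _
  apply Measurable.const_mul
  apply (hf.avg_iter hp _ m).2.1.comp
  fun_prop

theorem Phi_succ {p : ℝ} (hp : 1 ≤ p) {f : ℝ → ℝ} (hf : MemLpT p f) (s : ℕ) {η : ℝ} (hη : 0 < η)
    (m : ℕ) (h x : ℝ) :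
    Phi s η f (m + 1) h x = (1 / η) * ∫ u in (0:ℝ)..η, Phi s η f m (h + u) x := by
  unfold Phi
  rw [intervalIntegral.integral_finsetSum, Finset.mul_sum]
  · apply Finset.sum_congr rfl
    intro ν _
    rw [Function.iterate_succ_apply', avg_scaled hη, intervalIntegral.integral_const_mul]
    have : ∀ u : ℝ, x + ((s - ν : ℕ) : ℝ) * (h + u) =
        x + ((s - ν : ℕ) : ℝ) * h + ((s - ν : ℕ) : ℝ) * u := fun u => by ring
    simp only [this]
    ring
  · intro ν _
    apply IntervalIntegrable.const_mul
    have hk := (hf.avg_iter hp (((s - ν : ℕ) : ℝ) * η) m).intervalIntegrable hp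
    set k : ℝ := ((s - ν : ℕ) : ℝ) with hkdef
    by_cases hk0 : k = 0
    · simp [hk0]
    have h1 := (hk (k * 0 + (x + k * h)) (k * η + (x + k * h))).comp_add_right (x + k * h)
    simp only [add_sub_cancel_right] at h1
    have h2 := h1.comp_mul_left (c := k)
    have e1 : k * 0 / k = 0 := by simp
    have e2 : k * η / k = η := by field_simp
    rw [e1, e2] at h2
    exact h2.congr (by intro u _; simp only; ring_nf)

theorem Phi_le {p : ℝ} (hp : 1 ≤ p) {f : ℝ → ℝ} (hf : MemLpT p f) {s : ℕ} (hs : 1 ≤ s)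
    {η δ : ℝ} (hη : 0 < η) (m : ℕ) :
    ∀ h : ℝ, 0 ≤ h → h + m * η < δ → LpNorm p (Phi s η f m h) ≤ omegaMod s p f δ := by
  induction m with
  | zero =>
    intro h h0 h1
    have e : Phi s η f 0 h = Delta s h f := funext fun x => Phi_zero s η f h x
    rw [e]
    rcases h0.eq_or_lt with rfl | h0
    · have : Delta s 0 f = fun _ => 0 := funext fun x => Delta_step_zero hs f x
      rw [this, LpNorm_zero hp]
      exact omegaMod_nonneg _ _ _ _
    · exact le_omegaMod hp hf s h0 (by simpa using h1)
  | succ m ih =>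
    intro h h0 h1
    have hmem := Phi_memLpT hp hf s η (m + 1) h
    refine (minkowski_avg hp hη (Phi_measurable hp hf s η m h) ?_ ?_ hmem.1 hmem.2.1
      (fun x => Phi_succ hp hf s hη m h x)).2
    · exact fun u _ => Phi_memLpT hp hf s η m (h + u)
    · intro u hu
      apply ih (h + u) (by linarith [hu.1])
      push_cast at h1
      linarith [hu.2]

/-- The smooth approximant. -/
theorem exists_smooth {p : ℝ} (hp : 1 ≤ p) {f : ℝ → ℝ} (hf : MemLpT p f) {s : ℕ} (hs : 1 ≤ s)
    {n : ℕ} (hn : 1 ≤ n) :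
    ∃ g : ℝ → ℝ, SobolevW s g ∧
      LpNorm p (fun x => f x - g x) ≤ omegaMod s p f (1 / (n : ℝ)) ∧
      LpNorm p (iteratedDeriv s g) ≤
        (2 ^ s * (2 * ((s : ℝ) + 1)) ^ s) * (n : ℝ) ^ s * omegaMod s p f (1 / (n : ℝ)) := by
  have hn' : (0:ℝ) < n := by exact_mod_cast hn
  set η : ℝ := 1 / (2 * ((s : ℝ) + 1) * n) with hηdef
  have hη : 0 < η := by positivity
  have hsη : ((s : ℝ) + 1) * η < 1 / n := by
    rw [hηdef]
    have : ((s : ℝ) + 1) * (1 / (2 * ((s : ℝ) + 1) * n)) = (1 / n) / 2 := by field_simp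
    rw [this]
    exact half_lt_self (by positivity)
  set ω := omegaMod s p f (1 / (n : ℝ)) with hω
  have hω0 : 0 ≤ ω := omegaMod_nonneg _ _ _ _
  set c : ℕ → ℝ := fun ν => -(-1 : ℝ) ^ s * ((-1 : ℝ) ^ ν * (s.choose ν : ℝ)) with hc
  set a : ℕ → ℝ := fun ν => ((s - ν : ℕ) : ℝ) * η with ha
  have ha0 : ∀ ν ∈ Finset.range s, 0 < a ν := by
    intro ν hν
    have : 0 < s - ν := by simp at hν; omega
    have : (0:ℝ) < ((s - ν : ℕ) : ℝ) := by exact_mod_cast this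
    positivity
  have haη : ∀ ν ∈ Finset.range s, η ≤ a ν := by
    intro ν hν
    have : 1 ≤ s - ν := by simp at hν; omega
    have : (1:ℝ) ≤ ((s - ν : ℕ) : ℝ) := by exact_mod_cast this
    simp only [ha]
    nlinarith
  have ha1 : ∀ ν, a ν < 1 / n := by
    intro ν
    have : ((s - ν : ℕ) : ℝ) ≤ s := by exact_mod_cast Nat.sub_le _ _
    simp only [ha]
    nlinarith
  have hi := hf.intervalIntegrable hp
  have hcd : ∀ ν ∈ Finset.range s, ContDiff ℝ (s : ℕ∞) ((avg (a ν))^[s + 1] f) :=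
    fun ν hν => avg_iter_contDiff (ha0 ν hν).ne' hi s
  refine ⟨fun x => ∑ ν ∈ Finset.range s, c ν * (avg (a ν))^[s + 1] f x, ⟨?_, ?_⟩, ?_, ?_⟩
  · exact (MemLpT.sum hp _ fun ν _ => (hf.avg_iter hp _ _).const_mul hp _).1
  · apply ContDiff.sum
    intro ν hν
    exact contDiff_const.mul (hcd ν hν)
  · have e : (fun x => f x - ∑ ν ∈ Finset.range s, c ν * (avg (a ν))^[s + 1] f x) =
        fun x => (-1 : ℝ) ^ s * Phi s η f (s + 1) 0 x := by
      funext x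
      unfold Phi
      rw [Finset.sum_range_succ]
      have h1 : ((-1:ℝ) ^ s) * (-1) ^ s = 1 := by
        rw [← mul_pow]; simp
      have h2 : (avg (((s - s : ℕ) : ℝ) * η))^[s + 1] f = f := by
        simp only [Nat.sub_self, Nat.cast_zero, zero_mul]
        exact Function.iterate_fixed (avg_zero f) _
      rw [h2]
      simp only [mul_zero, add_zero, Nat.choose_self, Nat.cast_one, mul_one, hc, ha]
      rw [mul_add, ← mul_assoc, h1, one_mul, Finset.mul_sum, sub_eq_add_neg,
        ← Finset.sum_neg_distrib, add_comm (f x)]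
      congr 1
      apply Finset.sum_congr rfl
      intro ν _
      ring
    rw [e, LpNorm_const_mul hp _ (Phi_memLpT hp hf s η _ 0)]
    simp only [abs_pow, abs_neg, abs_one, one_pow, one_mul]
    apply Phi_le hp hf hs hη _ _ le_rfl
    push_cast
    linarith
  · have e : iteratedDeriv s (fun x => ∑ ν ∈ Finset.range s, c ν * (avg (a ν))^[s + 1] f x) =
        fun x => ∑ ν ∈ Finset.range s, (c ν * (1 / a ν) ^ s) * avg (a ν) (Delta s (a ν) f) x := by
      funext x
      rw [iteratedDeriv_fun_sum]
      · apply Finset.sum_congr rfl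
        intro ν hν
        have hcda := (hcd ν hν).contDiffAt (x := x)
        rw [iteratedDeriv_const_mul_field, avg_iter_iteratedDeriv (ha0 ν hν).ne' s hi]
        have : avg (a ν) (Delta s (a ν) f) x = Delta s (a ν) (avg (a ν) f) x := by
          have h0 := (ha0 ν hν).ne'
          unfold Delta
          rw [avg_eq h0, intervalIntegral.integral_finsetSum, Finset.mul_sum]
          · apply Finset.sum_congr rfl
            intro k _
            rw [intervalIntegral.integral_const_mul, avg_eq h0]
            simp only [add_right_comm x]
            ring
          · intro k _
            apply IntervalIntegrable.const_mul
            have := (hi (x + ((s:ℝ) - k) * a ν + 0) (x + ((s:ℝ) - k) * a ν + a ν)).comp_add_left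
              (x + ((s:ℝ) - k) * a ν)
            simp only [add_sub_cancel_left] at this
            exact this.congr (by intro u _; simp only; ring_nf)
        simp only [this]
        ring
      · intro ν hν
        exact (contDiff_const.mul (hcd ν hν)).contDiffAt
    have hmem : ∀ ν, MemLpT p (avg (a ν) (Delta s (a ν) f)) := fun ν =>
      (hf.Delta hp s (a ν)).avg hp _
    rw [e]
    calc _ ≤ ∑ ν ∈ Finset.range s, LpNorm p (fun x => (c ν * (1 / a ν) ^ s) *
              avg (a ν) (Delta s (a ν) f) x) :=
            LpNorm_sum_le hp _ fun ν _ => (hmem ν).const_mul hp _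
      _ ≤ ∑ ν ∈ Finset.range s, (s.choose ν : ℝ) * ((1 / η) ^ s * ω) := by
          apply Finset.sum_le_sum
          intro ν hν
          have hp0 := ha0 ν hν
          rw [LpNorm_const_mul hp _ (hmem ν), abs_mul]
          have h1 : |c ν| = (s.choose ν : ℝ) := by
            simp [hc, abs_mul, abs_pow]
          have h2 : |(1 / a ν) ^ s| ≤ (1 / η) ^ s := by
            rw [abs_of_nonneg (by positivity)]
            gcongr
            exact haη ν hν
          have h3 : LpNorm p (avg (a ν) (Delta s (a ν) f)) ≤ ω :=
            (LpNorm_avg_le hp (hf.Delta hp s (a ν)) hp0).trans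
              (le_omegaMod hp hf s hp0 (ha1 ν))
          rw [h1, mul_assoc]
          have := LpNorm_nonneg p (avg (a ν) (Delta s (a ν) f))
          gcongr
      _ = (∑ ν ∈ Finset.range s, (s.choose ν : ℝ)) * ((1 / η) ^ s * ω) := by
          rw [Finset.sum_mul]
      _ ≤ 2 ^ s * ((1 / η) ^ s * ω) := by
          gcongr
          have h : ∑ ν ∈ Finset.range (s + 1), (s.choose ν : ℝ) = 2 ^ s := by
            exact_mod_cast Nat.sum_range_choose s
          rw [Finset.sum_range_succ] at h
          simp at h
          linarith
      _ = _ := by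
          rw [hηdef, one_div_one_div, mul_pow]
          ring

theorem sep_sum {v : ℝ → ℝ} (hper : Function.Periodic v 1) (hv : ∀ x, 0 ≤ v x)
    (hi : ∀ a b, IntervalIntegrable v volume a b) {δ : ℝ} {n : ℕ} (hn : 1 ≤ n)
    {x : ℕ → ℝ} (hgap : ∀ k, k + 1 < n → δ ≤ x (k + 1) - x k) (hlast : δ ≤ 1 + x 0 - x (n - 1)) :
    ∑ k ∈ Finset.range n, ∫ t in (x k - δ / 2)..(x k + δ / 2), v t ≤ ∫ t in (0:ℝ)..1, v t := by
  have key : ∀ m, m + 1 ≤ n → ∑ k ∈ Finset.range (m + 1),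
      ∫ t in (x k - δ / 2)..(x k + δ / 2), v t ≤ ∫ t in (x 0 - δ / 2)..(x m + δ / 2), v t := by
    intro m
    induction m with
    | zero => intro _; simp
    | succ m ih =>
      intro hm
      rw [Finset.sum_range_succ]
      have h1 := ih (by omega)
      have h2 := hgap m (by omega)
      have h3 : 0 ≤ ∫ t in (x m + δ / 2)..(x (m + 1) - δ / 2), v t :=
        intervalIntegral.integral_nonneg (by linarith) fun t _ => hv t
      have h4 := intervalIntegral.integral_add_adjacent_intervals
        (hi (x 0 - δ / 2) (x m + δ / 2)) (hi (x m + δ / 2) (x (m + 1) - δ / 2))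
      have h5 := intervalIntegral.integral_add_adjacent_intervals
        (hi (x 0 - δ / 2) (x (m + 1) - δ / 2)) (hi (x (m + 1) - δ / 2) (x (m + 1) + δ / 2))
      linarith
  have h1 := key (n - 1) (by omega)
  rw [Nat.sub_add_cancel hn] at h1
  have h2 : 0 ≤ ∫ t in (x (n - 1) + δ / 2)..(x 0 - δ / 2 + 1), v t :=
    intervalIntegral.integral_nonneg (by linarith) fun t _ => hv t
  have h3 := intervalIntegral.integral_add_adjacent_intervals
    (hi (x 0 - δ / 2) (x (n - 1) + δ / 2)) (hi (x (n - 1) + δ / 2) (x 0 - δ / 2 + 1))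
  have h4 := hper.intervalIntegral_add_eq (x 0 - δ / 2) 0
  rw [zero_add] at h4
  linarith

theorem ellp_le {p : ℝ} (hp : 1 ≤ p) {γ : ℝ} (hγ : 0 < γ) {X : ℕ → ℕ → ℝ} (hX : NodesOK γ X)
    {n : ℕ} (hn : 1 ≤ n) {u v : ℝ → ℝ} (hv : MemLpT p v) {M : ℝ} (hM : 0 ≤ M)
    (hu : ∀ x, |u x| ≤ M * ((1 / (γ / n)) * ∫ t in (x - γ / n / 2)..(x + γ / n / 2), |v t|)) :
    ellp p n (X n) u ≤ M * (1 / γ) ^ (1 / p) * LpNorm p v := by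
  have hp0 : 0 < p := by linarith
  have hn' : (0:ℝ) < n := by exact_mod_cast hn
  obtain ⟨-, -, -, hgap, hlast⟩ := hX n hn
  set δ : ℝ := γ / n with hδdef
  have hδ : 0 < δ := by positivity
  have hper : Function.Periodic (fun x => |v x| ^ p) 1 := fun x => by simp only [hv.1 x]
  have hsum := sep_sum hper (fun x => by positivity) hv.intervalIntegrable_rpow hn hgap hlast
  have hpt : ∀ x, |u x| ^ p ≤ M ^ p * ((1 / δ) * ∫ t in (x - δ / 2)..(x + δ / 2), |v t| ^ p) := by
    intro x
    have hend : x + δ / 2 = (x - δ / 2) + δ := by ring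
    have hI : 0 ≤ ∫ t in (x - δ / 2)..(x + δ / 2), |v t| :=
      intervalIntegral.integral_nonneg (by linarith) fun t _ => abs_nonneg _
    have h1 : |u x| ^ p ≤ (M * ((1 / δ) * ∫ t in (x - δ / 2)..(x + δ / 2), |v t|)) ^ p :=
      Real.rpow_le_rpow (abs_nonneg _) (hu x) hp0.le
    rw [Real.mul_rpow hM (by positivity)] at h1
    refine h1.trans (mul_le_mul_of_nonneg_left ?_ (by positivity))
    have h2 := jensen_real hp (c := x - δ / 2) hδ (v := fun t => |v t|) hv.2.1.abs
      (by simpa using hv.intervalIntegrable_rpow _ _)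
    rw [← hend, abs_of_nonneg (by positivity)] at h2
    simpa using h2
  have hI1 : 0 ≤ ∫ t in (0:ℝ)..1, |v t| ^ p :=
    intervalIntegral.integral_nonneg zero_le_one fun t _ => by positivity
  have htot : (1 / (n : ℝ)) * ∑ k ∈ Finset.range n, |u (X n k)| ^ p ≤
      M ^ p * (1 / γ) * ∫ t in (0:ℝ)..1, |v t| ^ p := by
    calc _ ≤ (1 / (n : ℝ)) * ∑ k ∈ Finset.range n, M ^ p * ((1 / δ) *
            ∫ t in (X n k - δ / 2)..(X n k + δ / 2), |v t| ^ p) := by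
          gcongr with k hk
          exact hpt _
      _ = (1 / (n : ℝ)) * (M ^ p * ((1 / δ) * ∑ k ∈ Finset.range n,
            ∫ t in (X n k - δ / 2)..(X n k + δ / 2), |v t| ^ p)) := by
          rw [Finset.mul_sum (a := 1 / δ), Finset.mul_sum (a := M ^ p)]
      _ ≤ (1 / (n : ℝ)) * (M ^ p * ((1 / δ) * ∫ t in (0:ℝ)..1, |v t| ^ p)) := by
          gcongr
      _ = _ := by
          rw [hδdef]
          field_simp
  unfold ellp LpNorm
  have hroot : (M ^ p) ^ (1 / p) = M := by
    rw [← Real.rpow_mul hM, mul_one_div_cancel hp0.ne', Real.rpow_one]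
  calc _ ≤ (M ^ p * (1 / γ) * ∫ t in (0:ℝ)..1, |v t| ^ p) ^ (1 / p) := by
        apply Real.rpow_le_rpow _ htot (by positivity)
        exact mul_nonneg (by positivity) (Finset.sum_nonneg fun k _ => by positivity)
    _ = _ := by
        rw [Real.mul_rpow (by positivity) hI1, Real.mul_rpow (by positivity) (by positivity), hroot]

theorem ellp_add_le {p : ℝ} (hp : 1 ≤ p) (n : ℕ) (x : ℕ → ℝ) (f g : ℝ → ℝ) :
    ellp p n x (fun t => f t + g t) ≤ ellp p n x f + ellp p n x g := by
  have hp0 : 0 < p := by linarith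
  have h0 : ∀ h : ℝ → ℝ, 0 ≤ ∑ k ∈ Finset.range n, |h (x k)| ^ p := fun h =>
    Finset.sum_nonneg fun k _ => by positivity
  unfold ellp
  rw [Real.mul_rpow (by positivity) (h0 _), Real.mul_rpow (by positivity) (h0 _),
    Real.mul_rpow (by positivity) (h0 fun t => f t + g t), ← mul_add]
  gcongr
  exact Real.Lp_add_le (Finset.range n) (fun k => f (x k)) (fun k => g (x k)) hp

theorem ellp_sub_comm (p : ℝ) (n : ℕ) (x : ℕ → ℝ) (f g : ℝ → ℝ) :
    ellp p n x (fun t => f t - g t) = ellp p n x (fun t => g t - f t) := by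
  unfold ellp
  simp only [abs_sub_comm]

theorem ellp_nonneg (p : ℝ) (n : ℕ) (x : ℕ → ℝ) (f : ℝ → ℝ) : 0 ≤ ellp p n x f := by
  unfold ellp
  apply Real.rpow_nonneg
  exact mul_nonneg (by positivity) (Finset.sum_nonneg fun k _ => by positivity)

theorem ii_comp_affine {h : ℝ → ℝ} (hi : ∀ a b, IntervalIntegrable h volume a b) (x κ a b : ℝ) :
    IntervalIntegrable (fun t => h (x + κ * t)) volume a b := by
  by_cases hk : κ = 0
  · simp [hk]
  have h1 := (hi (x + κ * a) (x + κ * b)).comp_add_left x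
  simp only [add_sub_cancel_left] at h1
  have h2 := h1.comp_mul_left (c := κ)
  rwa [mul_div_cancel_left₀ _ hk, mul_div_cancel_left₀ _ hk] at h2

theorem steklov_sub {f g : ℝ → ℝ} (hf : ∀ a b, IntervalIntegrable f volume a b)
    (hg : ∀ a b, IntervalIntegrable g volume a b) (r : ℕ) (δ x : ℝ) :
    steklov r δ (fun t => f t - g t) x = steklov r δ f x - steklov r δ g x := by
  unfold steklov
  rw [← mul_sub,
    intervalIntegral.integral_finsetSum (fun ν _ => (ii_comp_affine
      (fun a b => (hf a b).sub (hg a b)) _ _ _ _).const_mul _),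
    intervalIntegral.integral_finsetSum (fun ν _ => (ii_comp_affine hf _ _ _ _).const_mul _),
    intervalIntegral.integral_finsetSum (fun ν _ => (ii_comp_affine hg _ _ _ _).const_mul _),
    ← Finset.sum_sub_distrib]
  congr 1
  refine Finset.sum_congr rfl fun ν _ => ?_
  rw [← intervalIntegral.integral_sub ((ii_comp_affine hf _ _ _ _).const_mul _)
    ((ii_comp_affine hg _ _ _ _).const_mul _)]
  congr 1
  funext t
  ring

theorem choose_inv_le_one (r : ℕ) : (((2 * r).choose r : ℝ))⁻¹ ≤ 1 := by
  apply inv_le_one_of_one_le₀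
  exact_mod_cast Nat.choose_pos (by omega)

/-- Pointwise bound of the Steklov average. -/
theorem steklov_abs_le {h : ℝ → ℝ} (hi : ∀ a b, IntervalIntegrable h volume a b) {r : ℕ}
    (hr : 1 ≤ r) {δ : ℝ} (hδ : 0 < δ) (x : ℝ) :
    |steklov r δ h x| ≤ (2 * r * 2 ^ (2 * r)) *
      ((1 / δ) * ∫ t in (x - δ / 2)..(x + δ / 2), |h t|) := by
  have hr' : (0:ℝ) < r := by exact_mod_cast hr
  set I := ∫ t in (x - δ / 2)..(x + δ / 2), |h t| with hI
  have hI0 : 0 ≤ I := intervalIntegral.integral_nonneg (by linarith) fun t _ => abs_nonneg _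
  have hterm : ∀ ν ∈ Finset.range r, |∫ t in (-(δ / 2))..(δ / 2),
      h (x + (((r : ℝ) - (ν : ℝ)) / (r : ℝ)) * t)| ≤ r * I := by
    intro ν hν
    have hν' : (ν : ℝ) + 1 ≤ r := by
      have : ν + 1 ≤ r := by simpa [Nat.succ_le_iff] using hν
      exact_mod_cast this
    set κ : ℝ := ((r : ℝ) - (ν : ℝ)) / (r : ℝ) with hκ
    have hκ0 : 0 < κ := div_pos (by linarith) hr'
    have hκ1 : κ ≤ 1 := by
      rw [hκ, div_le_one hr']
      have : (0:ℝ) ≤ ν := by positivity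
      linarith
    have hκr : κ⁻¹ ≤ r := by
      rw [hκ, inv_div, div_le_iff₀ (by linarith)]
      nlinarith
    rw [intervalIntegral.integral_comp_add_mul h hκ0.ne', smul_eq_mul, abs_mul,
      abs_of_pos (inv_pos.2 hκ0)]
    gcongr
    calc |∫ t in (x + κ * -(δ / 2))..(x + κ * (δ / 2)), h t|
        ≤ ∫ t in (x + κ * -(δ / 2))..(x + κ * (δ / 2)), |h t| :=
          intervalIntegral.abs_integral_le_integral_abs (by nlinarith)
      _ ≤ I := by
          apply intervalIntegral.integral_mono_interval (by nlinarith) (by nlinarith) (by nlinarith)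
          · exact Eventually.of_forall fun t => abs_nonneg _
          · exact (hi _ _).abs
  unfold steklov
  rw [intervalIntegral.integral_finsetSum (fun ν _ => (ii_comp_affine hi _ _ _ _).const_mul _)]
  simp only [intervalIntegral.integral_const_mul]
  have hs : |∑ ν ∈ Finset.range r, (-1 : ℝ) ^ ν * (((2 * r).choose ν : ℝ)) *
      ∫ t in (-(δ / 2))..(δ / 2), h (x + (((r : ℝ) - (ν : ℝ)) / (r : ℝ)) * t)| ≤
      2 ^ (2 * r) * (r * I) := by
    calc _ ≤ ∑ ν ∈ Finset.range r, (((2 * r).choose ν : ℝ)) * (r * I) := by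
          refine (Finset.abs_sum_le_sum_abs _ _).trans (Finset.sum_le_sum fun ν hν => ?_)
          rw [abs_mul, abs_mul, abs_pow, abs_neg, abs_one, one_pow, one_mul, Nat.abs_cast]
          exact mul_le_mul_of_nonneg_left (hterm ν hν) (by positivity)
      _ = (∑ ν ∈ Finset.range r, ((2 * r).choose ν : ℝ)) * (r * I) := by rw [Finset.sum_mul]
      _ ≤ _ := by
          gcongr
          have h : ∑ ν ∈ Finset.range (2 * r + 1), ((2 * r).choose ν : ℝ) = 2 ^ (2 * r) := by
            exact_mod_cast Nat.sum_range_choose (2 * r)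
          rw [← h]
          apply Finset.sum_le_sum_of_subset_of_nonneg
          · intro ν
            simp only [Finset.mem_range]
            omega
          · exact fun _ _ _ => by positivity
  rw [abs_mul, abs_mul, abs_mul, abs_pow, abs_neg, abs_one, one_pow, one_mul,
    abs_of_nonneg (by positivity : 0 ≤ (((2 * r).choose r : ℝ))⁻¹),
    abs_of_nonneg (by positivity : 0 ≤ 2 / δ)]
  calc _ ≤ 1 * (2 / δ) * (2 ^ (2 * r) * (r * I)) := by
        gcongr
        exact choose_inv_le_one r
    _ = _ := by ring

theorem sum_symm_split {r : ℕ} {a : ℕ → ℝ} (ha : ∀ ν, ν < r → a (2 * r - ν) = a ν) :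
    ∑ ν ∈ Finset.range (2 * r + 1), a ν = 2 * ∑ ν ∈ Finset.range r, a ν + a r := by
  have h1 : 2 * r + 1 = (r + 1) + r := by omega
  rw [h1, Finset.sum_range_add, Finset.sum_range_succ]
  have : ∑ k ∈ Finset.range r, a (r + 1 + k) = ∑ ν ∈ Finset.range r, a ν := by
    rw [← Finset.sum_range_reflect]
    apply Finset.sum_congr rfl
    intro ν hν
    have hν' : ν < r := by simpa using hν
    rw [← ha ν hν']
    congr 1
    omega
  rw [this]
  ring

theorem steklov_sub_self {g : ℝ → ℝ} (hi : ∀ a b, IntervalIntegrable g volume a b) {r : ℕ}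
    (hr : 1 ≤ r) {δ : ℝ} (hδ : 0 < δ) (x : ℝ) :
    steklov r δ g x - g x = (-1 : ℝ) ^ (r + 1) * (((2 * r).choose r : ℝ))⁻¹ * (1 / δ) *
      ∫ t in (-(δ / 2))..(δ / 2), Delta (2 * r) (t / r) g (x - t) := by
  have hr' : (0:ℝ) < r := by exact_mod_cast hr
  have e : ∀ t, Delta (2 * r) (t / r) g (x - t) = ∑ ν ∈ Finset.range (2 * r + 1),
      (-1 : ℝ) ^ ν * (((2 * r).choose ν : ℝ)) * g (x + (((r : ℝ) - (ν : ℝ)) / (r : ℝ)) * t) := by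
    intro t
    unfold Delta
    apply Finset.sum_congr rfl
    intro ν _
    congr 2
    push_cast
    field_simp
    ring
  simp only [e]
  unfold steklov
  rw [intervalIntegral.integral_finsetSum (fun ν _ => (ii_comp_affine hi _ _ _ _).const_mul _),
    intervalIntegral.integral_finsetSum (fun ν _ => (ii_comp_affine hi _ _ _ _).const_mul _)]
  rw [sum_symm_split]
  · have hC : ((2 * r).choose r : ℝ) ≠ 0 := by
      exact_mod_cast (Nat.choose_pos (by omega)).ne'
    have h1 : ((-1:ℝ) ^ r) * (-1) ^ r = 1 := by
      rw [← mul_pow]; simp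
    simp only [sub_self, zero_div, zero_mul, add_zero, intervalIntegral.integral_const, smul_eq_mul]
    rw [mul_add, pow_succ]
    have h2 : (-1 : ℝ) ^ r * -1 * (((2 * r).choose r : ℝ))⁻¹ * (1 / δ) *
        ((δ / 2 - -(δ / 2)) * ((-1) ^ r * ((2 * r).choose r : ℝ) * g x)) = - g x := by
      have : (-1 : ℝ) ^ r * -1 * (((2 * r).choose r : ℝ))⁻¹ * (1 / δ) *
        ((δ / 2 - -(δ / 2)) * ((-1) ^ r * ((2 * r).choose r : ℝ) * g x)) =
        -(((-1:ℝ) ^ r) * (-1) ^ r) * ((((2 * r).choose r : ℝ))⁻¹ * ((2 * r).choose r : ℝ)) *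
          (δ * (1 / δ)) * g x := by ring
      rw [this, h1, inv_mul_cancel₀ hC, mul_one_div_cancel hδ.ne']
      ring
    rw [h2]
    ring
  · intro ν hν
    have hle : ν ≤ 2 * r := by omega
    rw [Nat.choose_symm hle, Nat.cast_sub hle]
    have hsg : (-1 : ℝ) ^ (2 * r - ν) = (-1) ^ ν := by
      have h2 : (-1 : ℝ) ^ (2 * r - ν) * (-1) ^ ν = 1 := by
        rw [← pow_add, Nat.sub_add_cancel hle]
        simp
      have h3 : ((-1:ℝ) ^ ν) * (-1) ^ ν = 1 := by
        rw [← mul_pow]; simp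
      have h4 : (-1 : ℝ) ^ ν ≠ 0 := by positivity
      exact mul_right_cancel₀ h4 (h2.trans h3.symm)
    rw [hsg, intervalIntegral.integral_const_mul, intervalIntegral.integral_const_mul]
    congr 1
    have hneg := intervalIntegral.integral_comp_neg (a := -(δ / 2)) (b := δ / 2)
      (fun t => g (x + (((r : ℝ) - (ν : ℝ)) / (r : ℝ)) * t))
    rw [neg_neg] at hneg
    rw [← hneg]
    congr 1
    funext t
    congr 1
    push_cast
    ring

theorem Delta_hasDerivAt {g : ℝ → ℝ} (hg : Differentiable ℝ g) (m : ℕ) (h y : ℝ) :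
    HasDerivAt (Delta m h g) (Delta m h (deriv g) y) y := by
  unfold Delta
  apply HasDerivAt.fun_sum
  intro ν _
  exact ((hg _).hasDerivAt.comp_add_const y _).const_mul _

/-- Local bound for differences of smooth functions. -/
theorem Delta_abs_le (m : ℕ) : ∀ (s : ℕ) (g : ℝ → ℝ) (h y a b : ℝ), s + 1 ≤ m →
    ContDiff ℝ ((s + 1 : ℕ) : ℕ∞) g → y ∈ Set.Icc a b → y + m * h ∈ Set.Icc a b →
    |Delta m h g y| ≤ 2 ^ m * |h| ^ s * ∫ t in a..b, |iteratedDeriv (s + 1) g t| := by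
  induction m with
  | zero => intro s g h y a b hs; omega
  | succ m ih =>
    intro s g h y a b hs hg hy hyh
    have hab : a ≤ b := hy.1.trans hy.2
    have hm0 : (0:ℝ) ≤ m := by positivity
    push_cast at hyh
    obtain ⟨hy1, hy2⟩ := hy
    obtain ⟨hz1, hz2⟩ := hyh
    have hJ0 : 0 ≤ ∫ t in a..b, |iteratedDeriv (s + 1) g t| :=
      intervalIntegral.integral_nonneg hab fun t _ => abs_nonneg _
    -- intermediate points
    have hmid : ∀ θ : ℝ, 0 ≤ θ → θ ≤ m + 1 → y + θ * h ∈ Set.Icc a b := by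
      intro θ h0 h1
      constructor
      · rcases le_total 0 h with hh | hh
        · nlinarith [mul_nonneg h0 hh]
        · nlinarith [mul_nonneg (sub_nonneg.2 h1) (neg_nonneg.2 hh)]
      · rcases le_total 0 h with hh | hh
        · nlinarith [mul_nonneg (sub_nonneg.2 h1) hh]
        · nlinarith [mul_nonneg h0 (neg_nonneg.2 hh)]
    have hdiff : Differentiable ℝ g := hg.differentiable (by simp)
    have hdc : Continuous (deriv g) := hg.continuous_deriv (by norm_cast; simp)
    rcases Nat.eq_zero_or_pos s with rfl | hs0
    · rcases Nat.eq_zero_or_pos m with rfl | hm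
      · rw [Delta_succ, Delta_zero, Delta_zero]
        have h1 : g (y + h) - g y = ∫ t in y..(y + h), deriv g t :=
          (intervalIntegral.integral_deriv_eq_sub (fun t _ => hdiff t)
            (hdc.intervalIntegrable _ _)).symm
        have h2 : |∫ t in y..(y + h), deriv g t| ≤ ∫ t in a..b, |deriv g t| := by
          have h3 := intervalIntegral.norm_integral_le_integral_norm_uIoc
            (f := deriv g) (μ := volume) (a := y) (b := y + h)
          rw [Real.norm_eq_abs] at h3
          refine h3.trans ?_
          rw [intervalIntegral.integral_of_le hab]
          apply setIntegral_mono_set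
          · exact (intervalIntegrable_iff_integrableOn_Ioc_of_le hab).1
              (hdc.abs.intervalIntegrable _ _)
          · exact Eventually.of_forall fun t => abs_nonneg _
          · apply LE.le.eventuallyLE
            have := hmid 1 zero_le_one (by simp)
            rw [one_mul] at this
            exact Set.Ioc_subset_Ioc (le_min hy1 this.1) (max_le hy2 this.2)
        simp only [zero_add, iteratedDeriv_one, pow_zero, pow_one, mul_one] at hJ0 ⊢
        rw [h1]
        linarith
      · rw [Delta_succ]
        have e1 := hmid 1 zero_le_one (by linarith)
        have e2 := hmid m hm0 (by linarith)
        have h1 := ih 0 g h (y + h) a b hm hg (by simpa using e1)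
          ⟨by linarith, by linarith⟩
        have h2 := ih 0 g h y a b hm hg ⟨hy1, hy2⟩ e2
        have := abs_sub (Delta m h g (y + h)) (Delta m h g y)
        rw [pow_succ]
        linarith
    · obtain ⟨q, rfl⟩ : ∃ q, s = q + 1 := ⟨s - 1, by omega⟩
      have hg' : ContDiff ℝ ((q + 1 : ℕ) : ℕ∞) (deriv g) := by
        have : ((q + 1 + 1 : ℕ) : ℕ∞) = ((q + 1 : ℕ) : ℕ∞) + 1 := by push_cast; rfl
        rw [this] at hg
        push_cast at hg
        push_cast
        exact (contDiff_succ_iff_deriv.1 hg).2.2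
      have hc : Continuous (Delta m h (deriv g)) := by
        unfold Delta
        fun_prop
      have h1 : Delta (m + 1) h g y = ∫ t in y..(y + h), Delta m h (deriv g) t := by
        rw [Delta_succ]
        exact (intervalIntegral.integral_eq_sub_of_hasDerivAt
          (fun t _ => Delta_hasDerivAt hdiff m h t) (hc.intervalIntegrable _ _)).symm
      rw [h1, ← Real.norm_eq_abs]
      have h2 := intervalIntegral.norm_integral_le_of_norm_le_const
        (f := Delta m h (deriv g)) (a := y) (b := y + h)
        (C := 2 ^ m * |h| ^ q * ∫ t in a..b, |iteratedDeriv (q + 1 + 1) g t|) (by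
          intro t ht
          rw [Real.norm_eq_abs]
          have h3 := ih q (deriv g) h t a b (by omega) hg'
          rw [← iteratedDeriv_succ'] at h3
          have hθ : ∃ θ : ℝ, 0 ≤ θ ∧ θ ≤ 1 ∧ t = y + θ * h := by
            have ht' : t ∈ Set.uIcc y (y + h) := Set.uIoc_subset_uIcc ht
            rw [← segment_eq_uIcc, segment_eq_image'] at ht'
            obtain ⟨θ, hθ, rfl⟩ := ht'
            exact ⟨θ, hθ.1, hθ.2, by simp⟩
          obtain ⟨θ, hθ0, hθ1, rfl⟩ := hθ
          apply h3
          · exact hmid θ hθ0 (by linarith)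
          · have := hmid (θ + m) (by linarith) (by linarith)
            rwa [add_mul, ← add_assoc] at this)
      refine h2.trans ?_
      rw [add_sub_cancel_left]
      have : (0:ℝ) ≤ 2 ^ m * |h| ^ (q + 1) * ∫ t in a..b, |iteratedDeriv (q + 1 + 1) g t| := by
        positivity
      calc _ = 2 ^ m * |h| ^ (q + 1) * ∫ t in a..b, |iteratedDeriv (q + 1 + 1) g t| := by ring
        _ ≤ 2 * (2 ^ m * |h| ^ (q + 1) * ∫ t in a..b, |iteratedDeriv (q + 1 + 1) g t|) := by
          linarith
        _ = _ := by ring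

theorem steklov_smooth_le {g : ℝ → ℝ} {s r : ℕ} (hs : 1 ≤ s) (hr : 1 ≤ r) (hsr : s ≤ 2 * r)
    (hg : ContDiff ℝ (s : ℕ∞) g) {δ : ℝ} (hδ : 0 < δ) (x : ℝ) :
    |steklov r δ g x - g x| ≤ (2 ^ (2 * r) * δ ^ s) *
      ((1 / δ) * ∫ t in (x - δ / 2)..(x + δ / 2), |iteratedDeriv s g t|) := by
  have hr' : (1:ℝ) ≤ r := by exact_mod_cast hr
  obtain ⟨q, rfl⟩ : ∃ q, s = q + 1 := ⟨s - 1, by omega⟩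
  set I := ∫ t in (x - δ / 2)..(x + δ / 2), |iteratedDeriv (q + 1) g t| with hI
  have hI0 : 0 ≤ I := intervalIntegral.integral_nonneg (by linarith) fun t _ => abs_nonneg _
  rw [steklov_sub_self (fun a b => hg.continuous.intervalIntegrable a b) hr hδ x]
  have h1 := intervalIntegral.norm_integral_le_of_norm_le_const
    (f := fun t => Delta (2 * r) (t / r) g (x - t)) (a := -(δ / 2)) (b := δ / 2)
    (C := 2 ^ (2 * r) * δ ^ q * I) (by
      intro t ht
      rw [Set.uIoc_of_le (by linarith)] at ht
      obtain ⟨ht1, ht2⟩ := ht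
      rw [Real.norm_eq_abs]
      have e : x - t + ((2 * r : ℕ) : ℝ) * (t / r) = x + t := by
        push_cast
        field_simp
        ring
      have h2 := Delta_abs_le (2 * r) q g (t / r) (x - t) (x - δ / 2) (x + δ / 2) hsr hg
        ⟨by linarith, by linarith⟩ (by rw [e]; exact ⟨by linarith, by linarith⟩)
      refine h2.trans ?_
      have h3 : |t / r| ≤ δ := by
        rw [abs_div, Nat.abs_cast]
        refine (div_le_self (abs_nonneg _) hr').trans ?_
        rw [abs_le]
        constructor <;> linarith
      gcongr)
  rw [Real.norm_eq_abs] at h1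
  have h4 : |δ / 2 - -(δ / 2)| = δ := by
    rw [show δ / 2 - -(δ / 2) = δ by ring, abs_of_pos hδ]
  rw [h4] at h1
  rw [abs_mul, abs_mul, abs_mul, abs_pow, abs_neg, abs_one, one_pow, one_mul,
    abs_of_nonneg (by positivity : 0 ≤ (((2 * r).choose r : ℝ))⁻¹),
    abs_of_nonneg (by positivity : 0 ≤ 1 / δ)]
  calc _ ≤ 1 * (1 / δ) * (2 ^ (2 * r) * δ ^ q * I * δ) := by
        gcongr
        exact choose_inv_le_one r
    _ = _ := by ring

theorem stmt6 (p γ : ℝ) (r s : ℕ) (X : ℕ → ℕ → ℝ) (φ : ℕ → ℕ → ℝ → ℝ)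
    (G : ℕ → (ℝ → ℝ) → ℝ → ℝ)
    (hp : 1 ≤ p) (hr : 1 ≤ r) (hs : 1 ≤ s) (hsr : s ≤ 2 * r)
    (hγ0 : 0 < γ) (hγ1 : γ ≤ 1) (hX : NodesOK γ X) (hGform : SamplingForm p X φ G)
    (K1 : ℝ) (hK1 : 0 < K1) (hc1 : CondC1 p K1 X G) (K2 : ℝ) (hK2 : 0 < K2) (hc1' : CondC1' p K2 X G) (K3 : ℝ) (hK3 : 0 < K3) (hc2' : CondC2' p K3 s G)
    (f : ℝ → ℝ) (hf : MemLpT p f)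
    (hlittle : ∀ ε : ℝ, 0 < ε → ∃ N : ℕ, ∀ n : ℕ, N ≤ n →
      omegaMod s p f (1 / (n : ℝ)) ≤ ε * ellp p n (X n) (fun x => steklov r (γ / (n : ℝ)) f x - f x)) :
    ∃ c C : ℝ, ∃ N : ℕ, 0 < c ∧ 0 < C ∧ ∀ n : ℕ, N ≤ n →
      c * ellp p n (X n) (fun x => steklov r (γ / (n : ℝ)) f x - f x) ≤ LpNorm p (fun x => f x - G n f x) ∧
        LpNorm p (fun x => f x - G n f x) ≤ C * ellp p n (X n) (fun x => steklov r (γ / (n : ℝ)) f x - f x) := by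
  have hγp : (0:ℝ) ≤ (1 / γ) ^ (1 / p) := by positivity
  set D : ℝ := 2 ^ s * (2 * ((s : ℝ) + 1)) ^ s with hD
  have hD0 : 0 ≤ D := by positivity
  set B : ℝ := (2 * r * 2 ^ (2 * r)) * (1 / γ) ^ (1 / p) +
    2 ^ (2 * r) * (1 / γ) ^ (1 / p) * D with hB
  have hB0 : 0 ≤ B := by positivity
  -- the key estimate
  have key : ∀ n : ℕ, 1 ≤ n →
      LpNorm p (fun x => f x - G n f x) ≤ (1 + K3 * D + K1 * B) * omegaMod s p f (1 / (n : ℝ)) +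
        K1 * ellp p n (X n) (fun x => steklov r (γ / (n : ℝ)) f x - f x) ∧
      K2 * ellp p n (X n) (fun x => steklov r (γ / (n : ℝ)) f x - f x) ≤
        LpNorm p (fun x => f x - G n f x) +
          (1 + K3 * D + K2 * B) * omegaMod s p f (1 / (n : ℝ)) := by
    intro n hn
    have hn' : (0:ℝ) < n := by exact_mod_cast hn
    obtain ⟨g, hgS, hfg, hgs⟩ := exists_smooth hp hf hs hn
    rw [← hD] at hgs
    set ω := omegaMod s p f (1 / (n : ℝ)) with hω
    have hω0 : 0 ≤ ω := omegaMod_nonneg _ _ _ _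
    set E := ellp p n (X n) (fun x => steklov r (γ / (n : ℝ)) f x - f x) with hE
    have hδ : 0 < γ / (n : ℝ) := by positivity
    have hg : MemLpT p g := MemLpT.of_continuous hp hgS.1 hgS.2.continuous
    have hfgm : MemLpT p (fun x => f x - g x) := hf.sub hp hg
    have hgd : MemLpT p (iteratedDeriv s g) := by
      apply MemLpT.of_continuous hp
      · intro x
        have h1 : (fun y => g (y + 1)) = g := funext hgS.1
        have h2 := iteratedDeriv_comp_add_const s g 1
        rw [h1] at h2
        exact (congrFun h2 x).symm
      · exact hgS.2.continuous_iteratedDeriv s le_rfl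
    have hGm : ∀ u : ℝ → ℝ, MemLpT p (G n u) := by
      intro u
      have : G n u = fun x => ∑ k ∈ Finset.range n, u (X n k) * φ n k x :=
        funext fun x => hGform.2 n u x
      rw [this]
      exact MemLpT.sum hp _ fun k _ => (hGform.1 n k).const_mul hp _
    have hGsub : ∀ x, G n (fun t => f t - g t) x = G n f x - G n g x := by
      intro x
      rw [hGform.2, hGform.2, hGform.2, ← Finset.sum_sub_distrib]
      exact Finset.sum_congr rfl fun _ _ => by ring
    -- smooth error
    have hgG : LpNorm p (fun x => g x - G n g x) ≤ K3 * D * ω := by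
      refine (hc2' g hgS n hn).trans ?_
      calc K3 / (n : ℝ) ^ s * LpNorm p (iteratedDeriv s g)
          ≤ K3 / (n : ℝ) ^ s * (D * (n : ℝ) ^ s * ω) := by gcongr
        _ = _ := by field_simp
    -- discrete estimate
    have hst1 : ellp p n (X n) (steklov r (γ / (n : ℝ)) (fun t => f t - g t)) ≤
        (2 * r * 2 ^ (2 * r)) * (1 / γ) ^ (1 / p) * ω := by
      refine (ellp_le hp hγ0 hX hn hfgm (by positivity : (0:ℝ) ≤ 2 * r * 2 ^ (2 * r))
        (fun x => steklov_abs_le (hfgm.intervalIntegrable hp) hr hδ x)).trans ?_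
      gcongr
    have hst2 : ellp p n (X n) (fun x => steklov r (γ / (n : ℝ)) g x - g x) ≤
        2 ^ (2 * r) * (1 / γ) ^ (1 / p) * D * ω := by
      refine (ellp_le hp hγ0 hX hn hgd
        (by positivity : (0:ℝ) ≤ 2 ^ (2 * r) * (γ / (n : ℝ)) ^ s)
        (fun x => steklov_smooth_le hs hr hsr hgS.2 hδ x)).trans ?_
      have hγs : (γ / (n : ℝ)) ^ s ≤ (1 / (n : ℝ)) ^ s := by gcongr
      calc _ ≤ 2 ^ (2 * r) * (1 / (n : ℝ)) ^ s * (1 / γ) ^ (1 / p) *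
              (D * (n : ℝ) ^ s * ω) := by
            have := LpNorm_nonneg p (iteratedDeriv s g)
            gcongr
        _ = 2 ^ (2 * r) * ((1 / (n : ℝ)) * (n : ℝ)) ^ s * (1 / γ) ^ (1 / p) * (D * ω) := by
            rw [mul_pow]
            ring
        _ = _ := by
            rw [one_div_mul_cancel hn'.ne', one_pow]
            ring
    have hst : ellp p n (X n) (fun x => steklov r (γ / (n : ℝ)) f x - g x) ≤ B * ω := by
      have h1 := ellp_add_le hp n (X n) (steklov r (γ / (n : ℝ)) (fun t => f t - g t))
        (fun x => steklov r (γ / (n : ℝ)) g x - g x)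
      have e : (fun t => steklov r (γ / (n : ℝ)) (fun t => f t - g t) t +
          (steklov r (γ / (n : ℝ)) g t - g t)) =
          fun x => steklov r (γ / (n : ℝ)) f x - g x := by
        funext t
        rw [steklov_sub (hf.intervalIntegrable hp) (hg.intervalIntegrable hp)]
        ring
      rw [e] at h1
      refine h1.trans ?_
      rw [hB, add_mul]
      exact add_le_add hst1 hst2
    have hl1 : ellp p n (X n) (fun x => f x - g x) ≤ E + B * ω := by
      have h1 := ellp_add_le hp n (X n) (fun x => f x - steklov r (γ / (n : ℝ)) f x)
        (fun x => steklov r (γ / (n : ℝ)) f x - g x)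
      simp only [sub_add_sub_cancel] at h1
      rw [ellp_sub_comm p n (X n) f (steklov r (γ / (n : ℝ)) f)] at h1
      linarith
    have hl2 : E ≤ ellp p n (X n) (fun x => f x - g x) + B * ω := by
      have h1 := ellp_add_le hp n (X n) (fun x => steklov r (γ / (n : ℝ)) f x - g x)
        (fun x => g x - f x)
      simp only [sub_add_sub_cancel] at h1
      rw [ellp_sub_comm p n (X n) g f] at h1
      linarith
    have hG1 := hc1 _ hfgm n hn
    have hG2 := hc1' _ hfgm n hn
    have hGfg := hGm (fun t => f t - g t)
    have hgGm : MemLpT p (fun x => g x - G n g x) := hg.sub hp (hGm g)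
    have hfGm : MemLpT p (fun x => f x - G n f x) := hf.sub hp (hGm f)
    constructor
    · have h1 := LpNorm_add_le hp (hfgm.add hp hgGm) (hGfg.const_mul hp (-1))
      have h2 := LpNorm_add_le hp hfgm hgGm
      rw [LpNorm_const_mul hp _ hGfg, abs_neg, abs_one, one_mul] at h1
      have e : (fun x => f x - g x + (g x - G n g x) + -1 * G n (fun t => f t - g t) x) =
          fun x => f x - G n f x := by
        funext x
        rw [hGsub]
        ring
      rw [e] at h1
      have h3 := mul_le_mul_of_nonneg_left hl1 hK1.le
      linarith
    · have h1 := LpNorm_add_le hp (hfgm.add hp hgGm) (hfGm.const_mul hp (-1))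
      have h2 := LpNorm_add_le hp hfgm hgGm
      rw [LpNorm_const_mul hp _ hfGm, abs_neg, abs_one, one_mul] at h1
      have e : (fun x => f x - g x + (g x - G n g x) + -1 * (f x - G n f x)) =
          G n (fun t => f t - g t) := by
        funext x
        rw [hGsub]
        ring
      rw [e] at h1
      have h3 := mul_le_mul_of_nonneg_left hl2 hK2.le
      linarith
  set A1 : ℝ := 1 + K3 * D + K1 * B with hA1
  set A2 : ℝ := 1 + K3 * D + K2 * B with hA2
  have hA1p : 0 < A1 := by positivity
  have hA2p : 0 < A2 := by positivity
  obtain ⟨N1, hN1⟩ := hlittle 1 one_pos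
  obtain ⟨N2, hN2⟩ := hlittle (K2 / (2 * A2)) (by positivity)
  refine ⟨K2 / 2, A1 + K1, max 1 (max N1 N2), by positivity, by positivity, fun n hn => ?_⟩
  obtain ⟨hn1, hn2⟩ := max_le_iff.1 hn
  obtain ⟨hn2, hn3⟩ := max_le_iff.1 hn2
  obtain ⟨hU, hL⟩ := key n hn1
  have h1 := hN1 n hn2
  have h2 := hN2 n hn3
  set E := ellp p n (X n) (fun x => steklov r (γ / (n : ℝ)) f x - f x) with hE
  constructor
  · have h3 := mul_le_mul_of_nonneg_left h2 hA2p.le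
    have h4 : A2 * (K2 / (2 * A2) * E) = K2 / 2 * E := by field_simp
    rw [h4] at h3
    linarith
  · have h3 := mul_le_mul_of_nonneg_left h1 hA1p.le
    linarith
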